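/- arXiv:2311.01706 — 2 statements merged into one kernel-verified Lean document; each statement's English description precedes it below -/
import Mathlib

section
/- Let R be a commutative Noetherian ring and M a finitely generated R-module. If K is a regular p-prime extension of N in M, then for any submodule L of M with N ∩ L ≠ K ∩ L, the submodule K ∩ L is a regular p-prime extension of N ∩ L in L. -/
open Submodule

section Defs

variable {R : Type*} [CommRing R] {M : Type*} [AddCommGroup M] [Module R M]

/-- `K` is a `p`-prime extension of `N` (i.e. `N` is a `p`-prime submodule of `K`):
`(N : K) = p` and for all `a : R`, `x ∈ K`, `a • x ∈ N` implies `a ∈ p` or `x ∈ N`. -/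
def IsPrimeExtension (p : Ideal R) (N K : Submodule R M) : Prop :=
  p.IsPrime ∧ N ≤ K ∧ N.colon K = p ∧
    ∀ (a : R) (x : M), x ∈ K → a • x ∈ N → a ∈ p ∨ x ∈ N

/-- `K` is a maximal `p`-prime extension of `N` in the ambient module: no `p`-prime
extension of `N` properly contains `K`. -/
def IsMaximalPrimeExtension (p : Ideal R) (N K : Submodule R M) : Prop :=
  IsPrimeExtension p N K ∧ ∀ L : Submodule R M, IsPrimeExtension p N L → ¬ K < L

/-- `K` is a regular `p`-prime extension of `N` in the ambient module: `K` is a maximal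
`p`-prime extension of `N` and `p` is a maximal element of `Ass(M/N)`. -/
def IsRegularPrimeExtension (p : Ideal R) (N K : Submodule R M) : Prop :=
  IsMaximalPrimeExtension p N K ∧ p ∈ associatedPrimes R (M ⧸ N) ∧
    ∀ q ∈ associatedPrimes R (M ⧸ N), p ≤ q → q = p

/-- `F 0 = N ⊂ F 1 ⊂ ⋯ ⊂ F n = M` is a regular prime extension (RPE) filtration
of the ambient module over `N`, with prime ideals `p 0, …, p (n-1)`. -/
def IsRPEFiltration (N : Submodule R M) (n : ℕ) (F : Fin (n + 1) → Submodule R M)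
    (p : Fin n → Ideal R) : Prop :=
  F 0 = N ∧ F (Fin.last n) = ⊤ ∧
    ∀ i : Fin n, IsRegularPrimeExtension (p i) (F i.castSucc) (F i.succ)

/-- `N` has generalized prime ideal factorization given by the multiset `S` of primes. -/
def HasPFactorization (N : Submodule R M) (S : Multiset (Ideal R)) : Prop :=
  ∃ (n : ℕ) (F : Fin (n + 1) → Submodule R M) (p : Fin n → Ideal R),
    IsRPEFiltration N n F p ∧ (List.ofFn p : Multiset (Ideal R)) = S

end Defs

section Aux

variable {R : Type*} [CommRing R] {M : Type*} [AddCommGroup M] [Module R M]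
  {p : Ideal R} {N K : Submodule R M}

theorem IsPrimeExtension.smul_mem (h : IsPrimeExtension p N K) {a : R} (ha : a ∈ p)
    {x : M} (hx : x ∈ K) : a • x ∈ N := by
  rw [← h.2.2.1, Submodule.mem_colon] at ha
  exact ha x hx

/-- An element `x ∉ N` killed by `p` modulo `N` has annihilator `p` modulo `N`, provided `p` is
maximal among the associated primes of `M ⧸ N`. -/
theorem mem_of_smul_mem_of_maximal_associatedPrimes [IsNoetherianRing R]
    (hmax : ∀ q ∈ associatedPrimes R (M ⧸ N), p ≤ q → q = p) {x : M}
    (hpx : ∀ b ∈ p, b • x ∈ N) (hx : x ∉ N) {a : R} (ha : a • x ∈ N) : a ∈ p := by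
  have mem_colon_iff (b : R) :
      b ∈ (⊥ : Submodule R (M ⧸ N)).colon {N.mkQ x} ↔ b • x ∈ N := by
    rw [Submodule.mem_colon_singleton, Submodule.mem_bot, ← map_smul, Submodule.mkQ_apply,
      Submodule.Quotient.mk_eq_zero]
  obtain ⟨q, hq, hle⟩ := exists_le_isAssociatedPrime_of_isNoetherianRing R (N.mkQ x)
    (by rwa [Submodule.mkQ_apply, Ne, Submodule.Quotient.mk_eq_zero])
  rw [← hmax q hq fun b hb => hle ((mem_colon_iff b).2 (hpx b hb))]
  exact hle ((mem_colon_iff a).2 ha)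

theorem IsRegularPrimeExtension.mem_iff [IsNoetherianRing R]
    (h : IsRegularPrimeExtension p N K) {x : M} : x ∈ K ↔ ∀ a ∈ p, a • x ∈ N := by
  obtain ⟨⟨hK, hKmax⟩, -, hmax⟩ := h
  let K' : Submodule R M :=
    { carrier := {x | ∀ a ∈ p, a • x ∈ N}
      add_mem' := fun hx hy a ha => by
        rw [smul_add]
        exact N.add_mem (hx a ha) (hy a ha)
      zero_mem' := fun a _ => by simp
      smul_mem' := fun c x hx a ha => by
        rw [smul_comm]
        exact N.smul_mem c (hx a ha) }
  have hKK' : K ≤ K' := fun x hx a ha => hK.smul_mem ha hx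
  have hK' : IsPrimeExtension p N K' := by
    refine ⟨hK.1, hK.2.1.trans hKK', le_antisymm ?_ ?_, fun a x hx ha => ?_⟩
    · rw [← hK.2.2.1]
      exact Submodule.colon_mono le_rfl hKK'
    · exact fun a ha => Submodule.mem_colon.2 fun x hx => hx a ha
    · by_cases hxN : x ∈ N
      · exact Or.inr hxN
      · exact Or.inl (mem_of_smul_mem_of_maximal_associatedPrimes hmax hx hxN ha)
  have hKeq : K = K' := hKK'.eq_of_not_lt (hKmax K' hK')
  rw [hKeq]
  rfl

end Aux

/-- If `K` is a regular `p`-prime extension of `N` in `M`, then for any submodule `L`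
of `M` with `N ∩ L ≠ K ∩ L`, the submodule `K ∩ L` is a regular `p`-prime extension of
`N ∩ L` in `L` (the intersections being viewed as submodules of `L`). -/
theorem stmt_4 {R : Type*} [CommRing R] [IsNoetherianRing R]
    {M : Type*} [AddCommGroup M] [Module R M] [Module.Finite R M]
    (p : Ideal R) (N K : Submodule R M)
    (hreg : IsRegularPrimeExtension p N K)
    (L : Submodule R M) (hne : N ⊓ L ≠ K ⊓ L) :
    IsRegularPrimeExtension (M := L) p (N.comap L.subtype) (K.comap L.subtype) := by
  have hmem {x : M} : x ∈ K ↔ ∀ a ∈ p, a • x ∈ N := hreg.mem_iff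
  obtain ⟨⟨⟨hp, hNK, -, hprime⟩, -⟩, -, hmax⟩ := hreg
  obtain ⟨x, ⟨hxK, hxL⟩, hxN⟩ : ∃ x ∈ K ⊓ L, x ∉ N := by
    by_contra! h
    exact hne (le_antisymm (inf_le_inf_right L hNK) fun x hx => ⟨h x hx, hx.2⟩)
  have mem_of_smul_mem {a : R} (ha : a • x ∈ N) : a ∈ p :=
    (hprime a x hxK ha).resolve_right hxN
  refine ⟨⟨⟨hp, Submodule.comap_mono hNK, le_antisymm (fun a ha => ?_) fun a ha => ?_,
    fun a y hy hay => hprime a y hy hay⟩, fun K' hK' => ?_⟩, ?_, fun q hq => ?_⟩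
  · exact mem_of_smul_mem (Submodule.mem_colon.1 ha ⟨x, hxL⟩ hxK)
  · exact Submodule.mem_colon.2 fun y hy => hmem.1 hy a ha
  · exact not_lt_of_ge fun y hy => hmem.2 fun a ha => hK'.smul_mem ha hy
  · rw [AssociatedPrimes.mem_iff, isAssociatedPrime_iff]
    refine ⟨hp, (N.comap L.subtype).mkQ ⟨x, hxL⟩, ?_⟩
    ext a
    rw [Submodule.mem_colon_singleton, Submodule.mem_bot, ← map_smul, Submodule.mkQ_apply,
      Submodule.Quotient.mk_eq_zero]
    exact ⟨fun ha => hmem.1 hxK a ha, mem_of_smul_mem⟩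
  · refine hmax q (associatedPrimes.subset_of_injective
      (f := (N.comap L.subtype).mapQ N L.subtype le_rfl) ?_ hq)
    rw [← LinearMap.ker_eq_bot, Submodule.ker_mapQ, Submodule.mkQ_map_self]
end

section
/- Let R be a commutative Noetherian ring and let a, b be proper ideals of R having the same generalized prime ideal factorization, P_R(a) = P_R(b), which is a product of at most two prime ideals (i.e., the factorization consists of one prime p, or of two primes p_1, p_2 counted with multiplicity). Then the ideal a ∩ b has the same generalized prime ideal factorization: P_R(a ∩ b) = P_R(a). -/
open Submodule

section PrimeExtensionLemmas

variable {R : Type*} [CommRing R] {M : Type*} [AddCommGroup M] [Module R M]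

theorem HasPFactorization.cases_of_card_le_two {N : Submodule R M} {S : Multiset (Ideal R)}
    (h : HasPFactorization N S) (hN : N ≠ ⊤) (hcard : Multiset.card S ≤ 2) :
    (∃ p, S = {p} ∧ IsRegularPrimeExtension p N ⊤) ∨
      ∃ p q K, S = {p, q} ∧ IsRegularPrimeExtension p N K ∧ IsRegularPrimeExtension q K ⊤ := by
  obtain ⟨n, F, p, ⟨h0, hlast, hF⟩, rfl⟩ := h
  match n with
  | 0 => exact absurd (h0.symm.trans hlast) hN
  | 1 =>
    have h1 := hF 0
    rw [Fin.castSucc_zero, h0, Fin.succ_zero_eq_one, show (1 : Fin 2) = Fin.last 1 from rfl,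
      hlast] at h1
    exact .inl ⟨p 0, by simp, h1⟩
  | 2 =>
    have h1 := hF 0
    have h2 := hF 1
    rw [Fin.castSucc_zero, h0] at h1
    rw [show (1 : Fin 2).succ = Fin.last 2 from rfl, hlast] at h2
    exact .inr ⟨p 0, p 1, F 1, by simp [List.ofFn_succ]; rfl, h1, h2⟩
  | n + 3 => simp at hcard

theorem hasPFactorization_pair {p q : Ideal R} {N K : Submodule R M}
    (h : IsRegularPrimeExtension p N K) (h' : IsRegularPrimeExtension q K ⊤) :
    HasPFactorization N {p, q} := by
  refine ⟨2, ![N, K, ⊤], ![p, q], ⟨rfl, rfl, fun i => ?_⟩, by simp [List.ofFn_succ]; rfl⟩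
  fin_cases i
  · exact h
  · exact h'

theorem IsRegularPrimeExtension.eq_of_top {p I : Ideal R}
    (h : IsRegularPrimeExtension (M := R) p I ⊤) : I = p := by
  have := h.1.1.2.2.1
  rwa [Submodule.top_coe, colon_univ] at this

/-- An ideal whose regular `p`-prime extension is a prime `q` with `¬ q ≤ p` is `p ⊓ q`. -/
theorem IsRegularPrimeExtension.eq_inf {p q I : Ideal R}
    (h : IsRegularPrimeExtension (M := R) p I q) (hqp : ¬ q ≤ p) : I = p ⊓ q := by
  obtain ⟨⟨⟨-, hle, hcolon, hprime⟩, -⟩, -⟩ := h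
  have hmul : ∀ r ∈ p, ∀ x ∈ q, r * x ∈ I := fun r hr x hx => by
    rw [← hcolon, mem_colon] at hr
    exact hr x hx
  refine le_antisymm (le_inf (Ideal.le_colon.trans hcolon.le) hle) fun x hx => ?_
  obtain ⟨r, hrq, hrp⟩ := SetLike.not_le_iff_exists.1 hqp
  refine (hprime r x hx.2 ?_).resolve_left hrp
  rw [smul_eq_mul, mul_comm]
  exact hmul x hx.1 r hrq

variable [IsNoetherianRing R]

theorem mem_associatedPrimes_quotient_iff {N : Submodule R M} {q : Ideal R} :
    q ∈ associatedPrimes R (M ⧸ N) ↔ q.IsPrime ∧ ∃ x : M, ∀ r, r ∈ q ↔ r • x ∈ N := by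
  rw [AssociatedPrimes.mem_iff, isAssociatedPrime_iff]
  refine and_congr_right fun _ => ?_
  rw [(Submodule.mkQ_surjective N).exists]
  simp only [SetLike.ext_iff, mem_colon_singleton, Submodule.mem_bot,
    Submodule.mkQ_apply, ← Submodule.Quotient.mk_smul, Submodule.Quotient.mk_eq_zero]

/-- If `p` is not properly contained in any associated prime of `M ⧸ N` and kills a nonzero
element of `M ⧸ N`, then `p` is associated, and it is the annihilator of that element. -/
theorem mem_associatedPrimes_of_smul_mem {N : Submodule R M} {p : Ideal R}
    (hmax : ∀ q ∈ associatedPrimes R (M ⧸ N), p ≤ q → q = p) {x : M} (hx : x ∉ N)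
    (hpx : ∀ r ∈ p, r • x ∈ N) :
    p ∈ associatedPrimes R (M ⧸ N) ∧ ∀ r : R, r • x ∈ N → r ∈ p := by
  obtain ⟨q, hq, hle⟩ := exists_le_isAssociatedPrime_of_isNoetherianRing R
    (Submodule.Quotient.mk x : M ⧸ N) (by rwa [Ne, Submodule.Quotient.mk_eq_zero])
  have hle' : ∀ r : R, r • x ∈ N → r ∈ q := fun r hr => hle <| by
    rwa [mem_colon_singleton, Submodule.mem_bot, ← Submodule.Quotient.mk_smul,
      Submodule.Quotient.mk_eq_zero]
  obtain rfl := hmax q hq fun r hr => hle' r (hpx r hr)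
  exact ⟨hq, hle'⟩

theorem isRegularPrimeExtension_iff {p : Ideal R} {N K : Submodule R M} :
    IsRegularPrimeExtension p N K ↔
      p.IsPrime ∧ (∀ q ∈ associatedPrimes R (M ⧸ N), p ≤ q → q = p) ∧ ¬ K ≤ N ∧
        ∀ x, x ∈ K ↔ ∀ r ∈ p, r • x ∈ N := by
  have key : ∀ L : Submodule R M, p.IsPrime →
      (∀ q ∈ associatedPrimes R (M ⧸ N), p ≤ q → q = p) → ¬ L ≤ N →
      (∀ x, x ∈ L ↔ ∀ r ∈ p, r • x ∈ N) → IsPrimeExtension p N L := by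
    intro L hp hmax hLN hL
    obtain ⟨y, hyL, hyN⟩ := SetLike.not_le_iff_exists.1 hLN
    refine ⟨hp, fun x hx => (hL x).2 fun r _ => N.smul_mem r hx, ?_, fun r x hx hrx => ?_⟩
    · ext r
      rw [mem_colon]
      exact ⟨fun h => (mem_associatedPrimes_of_smul_mem hmax hyN ((hL y).1 hyL)).2 r (h y hyL),
        fun h s hs => (hL s).1 hs r h⟩
    · by_cases hxN : x ∈ N
      · exact .inr hxN
      · exact .inl ((mem_associatedPrimes_of_smul_mem hmax hxN ((hL x).1 hx)).2 r hrx)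
  have le_of_prime : ∀ L : Submodule R M, IsPrimeExtension p N L →
      ∀ x ∈ L, ∀ r ∈ p, r • x ∈ N := by
    intro L hL x hx r hr
    rw [← hL.2.2.1, mem_colon] at hr
    exact hr x hx
  constructor
  · rintro ⟨⟨hK, hKmax⟩, -, hmax⟩
    have hKN : ¬ K ≤ N := fun h => hK.1.ne_top <| by
      rw [← hK.2.2.1, colon_eq_top_iff_subset]; exact h
    refine ⟨hK.1, hmax, hKN, fun x => ⟨le_of_prime K hK x, fun hx => ?_⟩⟩
    let L : Submodule R M :=
      { carrier := {x | ∀ r ∈ p, r • x ∈ N}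
        add_mem' := fun hx hy r hr => by rw [smul_add]; exact N.add_mem (hx r hr) (hy r hr)
        zero_mem' := fun r _ => by rw [smul_zero]; exact N.zero_mem
        smul_mem' := fun c x hx r hr => by rw [smul_comm]; exact N.smul_mem c (hx r hr) }
    have hKL : K ≤ L := le_of_prime K hK
    have hL := key L hK.1 hmax (fun h => hKN (hKL.trans h)) fun _ => Iff.rfl
    exact (hKL.eq_or_lt.resolve_right (hKmax L hL)).ge hx
  · rintro ⟨hp, hmax, hKN, hK⟩
    obtain ⟨y, hyK, hyN⟩ := SetLike.not_le_iff_exists.1 hKN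
    exact ⟨⟨key K hp hmax hKN hK, fun L hL hlt =>
      hlt.not_ge fun x hx => (hK x).2 (le_of_prime L hL x hx)⟩,
      (mem_associatedPrimes_of_smul_mem hmax hyN ((hK y).1 hyK)).1, hmax⟩

/-- Submodules with a common regular `p`-prime extension `K` have an intersection with regular
`p`-prime extension `K`. -/
theorem IsRegularPrimeExtension.inf {p : Ideal R} {N N' K : Submodule R M}
    (h : IsRegularPrimeExtension p N K) (h' : IsRegularPrimeExtension p N' K) :
    IsRegularPrimeExtension p (N ⊓ N') K := by
  rw [isRegularPrimeExtension_iff] at h h' ⊢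
  obtain ⟨hp, hmax, hKN, hK⟩ := h
  obtain ⟨-, hmax', -, hK'⟩ := h'
  refine ⟨hp, fun q hq hpq => ?_, fun hle => hKN (hle.trans inf_le_left), fun x =>
    ⟨fun hx r hr => ⟨(hK x).1 hx r hr, (hK' x).1 hx r hr⟩,
      fun hx => (hK x).2 fun r hr => (hx r hr).1⟩⟩
  obtain ⟨hqp, x, hx⟩ := mem_associatedPrimes_quotient_iff.1 hq
  have hinf : N.colon {x} ⊓ N'.colon {x} = q := by
    ext r
    simp [hx, mem_colon_singleton]
  rcases (Ideal.IsPrime.inf_le hqp).1 hinf.le with hle | hle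
  · exact hmax q (mem_associatedPrimes_quotient_iff.2 ⟨hqp, x, fun r =>
      ⟨fun hr => ((hx r).1 hr).1, fun hr => hle (mem_colon_singleton.2 hr)⟩⟩) hpq
  · exact hmax' q (mem_associatedPrimes_quotient_iff.2 ⟨hqp, x, fun r =>
      ⟨fun hr => ((hx r).1 hr).2, fun hr => hle (mem_colon_singleton.2 hr)⟩⟩) hpq

theorem IsRegularPrimeExtension.eq_of_le {p q I : Ideal R} (hq : q ≠ ⊤)
    (h : IsRegularPrimeExtension (M := R) p I q) (hpq : p ≤ q) : p = q := by
  have hmem := (isRegularPrimeExtension_iff.1 h).2.2.2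
  refine le_antisymm hpq fun r hr => ?_
  have hpI : ¬ p ≤ I := fun hle => hq <| (Ideal.eq_top_iff_one q).2 <| (hmem 1).2 fun s hs => by
    simpa using hle hs
  obtain ⟨x, hxp, hxI⟩ := SetLike.not_le_iff_exists.1 hpI
  refine (h.1.1.2.2.2 r x (hpq hxp) ?_).resolve_right hxI
  rw [smul_eq_mul, mul_comm]
  exact (hmem r).1 hr x hxp

end PrimeExtensionLemmas

/-- If proper ideals `a` and `b` of a Noetherian ring have the same generalized prime
ideal factorization consisting of at most two prime factors (counted with
multiplicity), then `a ∩ b` has that same factorization. -/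
theorem stmt_9 {R : Type*} [CommRing R] [IsNoetherianRing R]
    (a b : Ideal R) (ha : a ≠ ⊤) (hb : b ≠ ⊤)
    (S : Multiset (Ideal R)) (hcard : Multiset.card S ≤ 2)
    (hfa : HasPFactorization (M := R) a S) (hfb : HasPFactorization (M := R) b S) :
    HasPFactorization (M := R) (a ⊓ b) S := by
  rcases hfa.cases_of_card_le_two ha hcard with ⟨p, hS, hap⟩ | ⟨p, q, k, hS, hap, hkq⟩ <;>
  rcases hfb.cases_of_card_le_two hb hcard with ⟨p', hS', hbp⟩ | ⟨p', q', k', hS', hbp, hkq'⟩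
  · obtain rfl : p = p' := Multiset.singleton_inj.1 (hS.symm.trans hS')
    rwa [hbp.eq_of_top, ← hap.eq_of_top, inf_idem]
  · simpa using congrArg Multiset.card (hS.symm.trans hS')
  · simpa using congrArg Multiset.card (hS.symm.trans hS')
  · obtain rfl := hkq.eq_of_top
    obtain rfl := hkq'.eq_of_top
    have hperm : [p, k].Perm [p', k'] := Multiset.coe_eq_coe.1 (hS.symm.trans hS')
    rcases List.perm_pair.1 hperm with heq | heq
    · obtain ⟨rfl, rfl⟩ : p = p' ∧ k = k' := by simpa using heq
      exact hS ▸ hasPFactorization_pair (hap.inf hbp) hkq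
    · obtain ⟨rfl, rfl⟩ : p = k' ∧ k = p' := by simpa using heq
      by_cases hpk : p = k
      · subst hpk
        exact hS ▸ hasPFactorization_pair (hap.inf hbp) hkq
      · have hab : a = b := by
          rw [hap.eq_inf fun hle => hpk (hbp.eq_of_le hkq'.1.1.1.ne_top hle).symm,
            hbp.eq_inf fun hle => hpk (hap.eq_of_le hkq.1.1.1.ne_top hle), inf_comm]
        rwa [← hab, inf_idem]
end
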